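/- Let M be a nonzero uniformly finite R-module, N a submodule with N ≠ M, and N = N₁ ∩ ⋯ ∩ N_s an irredundant primary decomposition of N in M with As_R(M/N_i) = {X_i} for each i. Then As_R(M/N) = As_R(M/N₁) ∪ ⋯ ∪ As_R(M/N_s) = {X₁, ..., X_s}. -/

import Mathlib

/-!
Definitions following Bavula, "Primary decompositions for left Noetherian rings".
All modules are left modules over an associative ring `R` with 1.
-/

universe u v

section Defs

variable (R : Type u) [Ring R]

/-- `N` is an essential submodule of the module `A`:
it intersects every nonzero submodule of `A` nontrivially. -/
def EssentialSub {A : Type v} [AddCommGroup A] [Module R A] (N : Submodule R A) : Prop :=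
  ∀ L : Submodule R A, L ≠ ⊥ → N ⊓ L ≠ ⊥

/-- A module `A` is uniform: it is nonzero and every nonzero submodule is essential. -/
def UniformMod (A : Type v) [AddCommGroup A] [Module R A] : Prop :=
  Nontrivial A ∧ ∀ V : Submodule R A, V ≠ ⊥ → EssentialSub R V

/-- A submodule is uniform if it is uniform as a module. -/
def UniformSub {A : Type v} [AddCommGroup A] [Module R A] (U : Submodule R A) : Prop :=
  UniformMod R ↥U

/-- `A` has finite uniform dimension:
it contains no infinite direct sum of nonzero submodules. -/
def FinUdim (A : Type v) [AddCommGroup A] [Module R A] : Prop :=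
  ¬ ∃ f : ℕ → Submodule R A, (∀ n, f n ≠ ⊥) ∧ iSupIndep f

/-- `A` has uniform dimension `n`: there is an essential direct sum of `n`
uniform submodules of `A`. -/
def UdimEq (A : Type v) [AddCommGroup A] [Module R A] (n : ℕ) : Prop :=
  ∃ U : Fin n → Submodule R A, (∀ i, UniformSub R (U i)) ∧
    iSupIndep U ∧ EssentialSub R (⨆ i, U i)

/-- Essential equivalence of modules: they possess isomorphic essential submodules. -/
def EssEquiv (A B : ModuleCat.{v} R) : Prop :=
  ∃ (L₁ : Submodule R A) (L₂ : Submodule R B),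
    EssentialSub R L₁ ∧ EssentialSub R L₂ ∧ Nonempty (L₁ ≃ₗ[R] L₂)

/-- The left spectrum-style quotient: classes `[A]` of modules under essential
equivalence (for uniform modules these classes are the left primes). -/
def LeftSpec := Quot (EssEquiv R)

/-- The class `[A]` of the module `A` under essential equivalence. -/
def leftPrime (A : Type v) [AddCommGroup A] [Module R A] : LeftSpec.{u, v} R :=
  Quot.mk _ (ModuleCat.of R A)

/-- The set `As_R(A)` of associated left primes of `A`:
the classes of the uniform submodules of `A`. -/
def leftAss (A : Type v) [AddCommGroup A] [Module R A] : Set (LeftSpec.{u, v} R) :=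
  { x | ∃ U : Submodule R A, UniformSub R U ∧ x = leftPrime R ↥U }

/-- `A` is uniformly finite: every factor module of `A` has finite uniform dimension. -/
def UniformlyFinite (A : Type v) [AddCommGroup A] [Module R A] : Prop :=
  ∀ N : Submodule R A, FinUdim R (A ⧸ N)

/-- `N` is an `X`-primary submodule of `A`: `A/N` has finite uniform dimension and
`As_R(A/N) = {X}`. -/
def PrimarySub {A : Type v} [AddCommGroup A] [Module R A] (N : Submodule R A)
    (X : LeftSpec.{u, v} R) : Prop :=
  FinUdim R (A ⧸ N) ∧ leftAss R (A ⧸ N) = {X}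

/-- `Ns` is a primary decomposition of `N` in `A`. -/
def IsPrimaryDecomp {A : Type v} [AddCommGroup A] [Module R A] (N : Submodule R A)
    (s : ℕ) (Ns : Fin s → Submodule R A) : Prop :=
  N = ⨅ i, Ns i ∧ ∀ i, ∃ X, PrimarySub R (Ns i) X

/-- `Ns` is a shortest primary decomposition of `N` in `A`:
no primary decomposition of `N` in `A` has fewer terms. -/
def IsShortestPrimaryDecomp {A : Type v} [AddCommGroup A] [Module R A] (N : Submodule R A)
    (s : ℕ) (Ns : Fin s → Submodule R A) : Prop :=
  IsPrimaryDecomp R N s Ns ∧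
    ∀ (t : ℕ) (Ls : Fin t → Submodule R A), IsPrimaryDecomp R N t Ls → s ≤ t

/-- `C` is a complement to `W` in the ambient module: `W ⊓ C = ⊥` and `C` is maximal
with this property. -/
def IsComplementTo {A : Type v} [AddCommGroup A] [Module R A] (C W : Submodule R A) : Prop :=
  W ⊓ C = ⊥ ∧ ∀ D : Submodule R A, C ≤ D → W ⊓ D = ⊥ → D = C

/-- A proper submodule `N ⊊ A` is irreducible if it is not the intersection of two
strictly larger submodules. -/
def IrreducibleSub {A : Type v} [AddCommGroup A] [Module R A] (N : Submodule R A) : Prop :=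
  N ≠ ⊤ ∧ ¬ ∃ P Q : Submodule R A, N < P ∧ N < Q ∧ N = P ⊓ Q

/-- The multiplicity of the left prime `x` in `A` is `m`: in some (equivalently, any)
essential direct sum of uniform submodules of `A`, exactly `m` summands lie in class `x`. -/
def HasMult (A : Type v) [AddCommGroup A] [Module R A] (x : LeftSpec.{u, v} R) (m : ℕ) : Prop :=
  ∃ (n : ℕ) (U : Fin n → Submodule R A), (∀ i, UniformSub R (U i)) ∧
    iSupIndep U ∧ EssentialSub R (⨆ i, U i) ∧
    m = Nat.card {i : Fin n // leftPrime R ↥(U i) = x}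

end Defs
section Helpers

variable {R : Type u} [Ring R]

/-- A sequence of submodules is independent if each term meets trivially a member of a decreasing
sequence that contains all the later terms. -/
theorem iSupIndep_of_disjoint_succ {A : Type v} [AddCommGroup A] [Module R A]
    {V B : ℕ → Submodule R A} (hB : Antitone B) (hV : ∀ n, V n ≤ B n)
    (hd : ∀ n, Disjoint (V n) (B (n + 1))) : iSupIndep V := by
  classical
  rw [iSupIndep_iff_supIndep]
  intro t
  induction t using Finset.induction_on_min with
  | empty => exact Finset.supIndep_empty V
  | insert i t hi ih =>
    refine ih.insert ((hd i).mono_right (Finset.sup_le fun j hj => ?_))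
    exact (hV j).trans (hB (hi j hj))

/-- A nonzero submodule that is not uniform contains two nonzero disjoint submodules. -/
theorem exists_disjoint_of_not_uniformSub {A : Type v} [AddCommGroup A] [Module R A]
    {W : Submodule R A} (hW : W ≠ ⊥) (h : ¬ UniformSub R W) :
    ∃ V B : Submodule R A, V ≤ W ∧ B ≤ W ∧ V ≠ ⊥ ∧ B ≠ ⊥ ∧ Disjoint V B := by
  have hnt : Nontrivial W := Submodule.nontrivial_iff_ne_bot.mpr hW
  simp only [UniformSub, UniformMod, EssentialSub, not_and, not_forall, not_not] at h
  obtain ⟨V, hV, L, hL, hVL⟩ := h hnt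
  have hinj : Function.Injective W.subtype := W.injective_subtype
  refine ⟨V.map W.subtype, L.map W.subtype, W.map_subtype_le V, W.map_subtype_le L, ?_, ?_, ?_⟩
  · simpa only [Submodule.map_bot] using (Submodule.map_injective_of_injective hinj).ne hV
  · simpa only [Submodule.map_bot] using (Submodule.map_injective_of_injective hinj).ne hL
  · rw [disjoint_iff, ← Submodule.map_inf _ hinj, hVL, Submodule.map_bot]

/-- In a module of finite uniform dimension every nonzero submodule contains a uniform one. -/
theorem FinUdim.exists_uniformSub_le {A : Type v} [AddCommGroup A] [Module R A]
    (hA : FinUdim R A) {C : Submodule R A} (hC : C ≠ ⊥) :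
    ∃ U : Submodule R A, U ≤ C ∧ UniformSub R U := by
  by_contra! hno
  have split (W : {W : Submodule R A // W ≠ ⊥ ∧ W ≤ C}) :
      ∃ (V : Submodule R A) (B : {W : Submodule R A // W ≠ ⊥ ∧ W ≤ C}),
        V ≤ W.1 ∧ B.1 ≤ W.1 ∧ V ≠ ⊥ ∧ Disjoint V B.1 := by
    obtain ⟨V, B, hV, hB, hV0, hB0, hVB⟩ :=
      exists_disjoint_of_not_uniformSub W.2.1 (hno W.1 W.2.2)
    exact ⟨V, ⟨B, hB0, hB.trans W.2.2⟩, hV, hB, hV0, hVB⟩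
  choose V B hV hB hV0 hVB using split
  let S (n : ℕ) : {W : Submodule R A // W ≠ ⊥ ∧ W ≤ C} := B^[n] ⟨C, hC, le_rfl⟩
  have hS (n : ℕ) : S (n + 1) = B (S n) := Function.iterate_succ_apply' B n _
  refine hA ⟨fun n => V (S n), fun n => hV0 _, iSupIndep_of_disjoint_succ (B := fun n => (S n).1)
    (antitone_nat_of_succ_le fun n => ?_) (fun n => hV _) fun n => ?_⟩
  · rw [hS]; exact hB _
  · rw [hS]; exact hVB _

theorem EssentialSub.top {A : Type v} [AddCommGroup A] [Module R A] :
    EssentialSub R (⊤ : Submodule R A) := fun L hL => by rwa [top_inf_eq]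

theorem leftPrime_eq_of_linearEquiv {A B : Type v} [AddCommGroup A] [Module R A]
    [AddCommGroup B] [Module R B] (e : A ≃ₗ[R] B) : leftPrime R A = leftPrime R B :=
  Quot.sound ⟨⊤, ⊤, EssentialSub.top, EssentialSub.top,
    ⟨Submodule.topEquiv.trans (e.trans Submodule.topEquiv.symm)⟩⟩

theorem UniformMod.of_linearEquiv {A B : Type v} [AddCommGroup A] [Module R A]
    [AddCommGroup B] [Module R B] (e : A ≃ₗ[R] B) (hA : UniformMod R A) : UniformMod R B := by
  have hne (K : Submodule R B) (hK : K ≠ ⊥) : K.map e.symm.toLinearMap ≠ ⊥ := by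
    simpa only [Submodule.map_bot] using
      (Submodule.map_injective_of_injective e.symm.injective).ne hK
  refine ⟨e.symm.toEquiv.nontrivial_congr.mpr hA.1, fun V hV L hL hVL => ?_⟩
  apply hA.2 _ (hne V hV) _ (hne L hL)
  rw [← Submodule.map_inf _ e.symm.injective, hVL, Submodule.map_bot]

/-- The class of a uniform module is associated to every module into which it embeds. -/
theorem UniformMod.leftPrime_mem_leftAss {A B : Type v} [AddCommGroup A] [Module R A]
    [AddCommGroup B] [Module R B] (hA : UniformMod R A) (f : A →ₗ[R] B)
    (hf : Function.Injective f) : leftPrime R A ∈ leftAss R B :=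
  ⟨LinearMap.range f, hA.of_linearEquiv (LinearEquiv.ofInjective f hf),
    leftPrime_eq_of_linearEquiv (LinearEquiv.ofInjective f hf)⟩

/-- A uniform submodule disjoint from the kernel of `f` has its class among the associated left
primes of the codomain of `f`. -/
theorem UniformSub.leftPrime_mem_leftAss {A B : Type v} [AddCommGroup A] [Module R A]
    [AddCommGroup B] [Module R B] {U : Submodule R A} (hU : UniformSub R U) (f : A →ₗ[R] B)
    (hf : Disjoint U (LinearMap.ker f)) : leftPrime R U ∈ leftAss R B :=
  UniformMod.leftPrime_mem_leftAss hU (f.domRestrict U)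
    (LinearMap.injective_domRestrict_iff.mpr hf)

/-- If finitely many submodules have zero intersection, then every uniform submodule is disjoint
from one of them. -/
theorem UniformSub.exists_disjoint {A : Type v} [AddCommGroup A] [Module R A]
    {U : Submodule R A} (hU : UniformSub R U) {ι : Type*} [Finite ι] (K : ι → Submodule R A)
    (hK : ⨅ i, K i = ⊥) : ∃ i, Disjoint U (K i) := by
  classical
  have := Fintype.ofFinite ι
  by_contra! hno
  have hne (t : Finset ι) : t.inf (fun i => (K i).comap U.subtype) ≠ ⊥ := by
    induction t using Finset.induction_on with
    | empty =>
      have := hU.1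
      exact top_ne_bot
    | insert i t _ ih =>
      rw [Finset.inf_insert]
      exact hU.2 _ (mt Submodule.disjoint_iff_comap_eq_bot.mpr (hno i)) _ ih
  apply hne Finset.univ
  rw [Finset.inf_univ_eq_iInf, ← Submodule.comap_iInf, hK]
  exact U.ker_subtype

end Helpers

/-- Theorem `RlufAss`(2): if `N = N₁ ∩ ⋯ ∩ N_s` is an irredundant
primary decomposition of a proper submodule `N` of a nonzero uniformly finite module
`M`, with `As_R(M/Nᵢ) = {Xᵢ}`, then
`As_R(M/N) = As_R(M/N₁) ∪ ⋯ ∪ As_R(M/N_s) = {X₁, …, X_s}`. -/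
theorem leftAss_eq_of_irredundant_primaryDecomposition
    {R : Type u} [Ring R] {M : Type v} [AddCommGroup M] [Module R M]
    (hM : Nontrivial M) (huf : UniformlyFinite R M)
    (N : Submodule R M) (hN : N ≠ ⊤)
    (s : ℕ) (Ns : Fin s → Submodule R M) (X : Fin s → LeftSpec.{u, v} R)
    (hdec : N = ⨅ i, Ns i) (hprim : ∀ i, PrimarySub R (Ns i) (X i))
    (hirr : ∀ i, (⨅ (j) (_ : j ≠ i), Ns j) ≠ N) :
    leftAss R (M ⧸ N) = ⋃ i, leftAss R (M ⧸ Ns i) ∧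
      leftAss R (M ⧸ N) = Set.range X := by
  have hle (i : Fin s) : N ≤ Ns i := hdec ▸ iInf_le Ns i
  let f (i : Fin s) : (M ⧸ N) →ₗ[R] (M ⧸ Ns i) := Submodule.factor (hle i)
  have hcomap (i : Fin s) : (LinearMap.ker (f i)).comap N.mkQ = Ns i := by
    rw [← LinearMap.ker_comp, Submodule.factor_comp_mk, Submodule.ker_mkQ]
  have hinj : Function.Injective (Submodule.comap N.mkQ) :=
    Submodule.comap_injective_of_surjective N.mkQ_surjective
  have hbot : (⊥ : Submodule R (M ⧸ N)).comap N.mkQ = N := N.ker_mkQ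
  have hker : ⨅ i, LinearMap.ker (f i) = ⊥ := hinj <| by
    simp only [Submodule.comap_iInf, hcomap, hbot, hdec.symm]
  have hunion : ⋃ i, leftAss R (M ⧸ Ns i) = Set.range X := by
    simp only [(hprim _).2, Set.iUnion_singleton_eq_range]
  have hmain : leftAss R (M ⧸ N) = ⋃ i, leftAss R (M ⧸ Ns i) := by
    apply subset_antisymm
    · rintro _ ⟨U, hU, rfl⟩
      obtain ⟨i, hi⟩ := hU.exists_disjoint _ hker
      exact Set.mem_iUnion.mpr ⟨i, hU.leftPrime_mem_leftAss (f i) hi⟩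
    · refine Set.iUnion_subset fun i => ?_
      rw [(hprim i).2, Set.singleton_subset_iff]
      have hD : (⨅ (j) (_ : j ≠ i), LinearMap.ker (f j)) ≠ ⊥ := fun h => hirr i <| by
        have := congrArg (Submodule.comap N.mkQ) h
        simpa only [Submodule.comap_iInf, hcomap, hbot] using this
      obtain ⟨U, hUD, hU⟩ := (huf N).exists_uniformSub_le hD
      have hdisj : Disjoint U (LinearMap.ker (f i)) := by
        refine Disjoint.mono_left hUD (disjoint_iff.mpr ?_)
        rw [← hker, iInf_split_single (fun j => LinearMap.ker (f j)) i, inf_comm]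
      have hX := hU.leftPrime_mem_leftAss (f i) hdisj
      rw [(hprim i).2, Set.mem_singleton_iff] at hX
      exact ⟨U, hU, hX.symm⟩
  exact ⟨hmain, hmain.trans hunion⟩
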